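/- Let X be a locally compact Hausdorff Polish space and k a reproducing kernel on X such that k(·,x) ∈ C₀(X) for all x ∈ X, and such that ∬ k(x,y) dμ(x) dμ(y) > 0 for every nonzero finite signed Borel measure μ on X. If (P_n) is a sequence of Borel probability measures on X and P is a Borel probability measure with D_k(P_n, P) → 0, then P_n converges weakly to P. -/

import Mathlib

open MeasureTheory
open scoped RealInnerProductSpace

lemma aux_limit {X : Type*} [TopologicalSpace X] [LocallyCompactSpace X] [T2Space X]
    [MeasurableSpace X] [BorelSpace X] (P : ℕ → Measure X) [∀ n, IsProbabilityMeasure (P n)]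
    (U : Ultrafilter ℕ) :
    ∃ Q : Measure X, IsFiniteMeasure Q ∧ ∀ g : X → ℝ, Continuous g →
      Filter.Tendsto g (Filter.cocompact X) (nhds 0) →
      Filter.Tendsto (fun n => ∫ x, g x ∂(P n)) U (nhds (∫ x, g x ∂Q)) := by
  let : MeasurableSpace (OnePoint X) := borel _
  have : BorelSpace (OnePoint X) := ⟨rfl⟩
  have hemb : MeasurableEmbedding ((↑) : X → OnePoint X) :=
    OnePoint.isOpenEmbedding_coe.measurableEmbedding
  let P' : ℕ → ProbabilityMeasure (OnePoint X) := fun n =>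
    ⟨(P n).map ((↑) : X → OnePoint X),
      Measure.isProbabilityMeasure_map hemb.measurable.aemeasurable⟩
  obtain ⟨ν, -, hν⟩ := isCompact_univ.ultrafilter_le_nhds (U.map P') (by simp)
  have hν' : Filter.Tendsto P' U (nhds ν) := hν
  rw [ProbabilityMeasure.tendsto_iff_forall_integral_tendsto] at hν'
  refine ⟨(ν : Measure (OnePoint X)).comap ((↑) : X → OnePoint X), ?_, ?_⟩
  · refine ⟨?_⟩
    rw [hemb.comap_apply]
    exact measure_lt_top _ _
  intro g hg hg0
  let e : OnePoint X → ℝ := fun z => z.elim 0 g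
  have he : Continuous e := by
    rw [OnePoint.continuous_iff]
    refine ⟨?_, ?_⟩
    · rw [Filter.coclosedCompact_eq_cocompact]
      exact hg0
    · exact hg
  have h1 := hν' (BoundedContinuousFunction.mkOfCompact ⟨e, he⟩)
  have h2 : ∀ n, ∫ z, e z ∂(P' n : Measure (OnePoint X)) = ∫ x, g x ∂(P n) := fun n => by
    change ∫ z, e z ∂((P n).map ((↑) : X → OnePoint X)) = _
    rw [hemb.integral_map]
    rfl
  have h3 : ∫ z, e z ∂(ν : Measure (OnePoint X))
      = ∫ x, g x ∂((ν : Measure (OnePoint X)).comap ((↑) : X → OnePoint X)) := by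
    have h4 := hemb.integral_map (μ := (ν : Measure (OnePoint X)).comap ((↑) : X → OnePoint X)) e
    rw [hemb.map_comap, setIntegral_eq_integral_of_forall_compl_eq_zero] at h4
    · exact h4
    · intro z hz
      induction z using OnePoint.rec with
      | infty => rfl
      | coe x => exact absurd ⟨x, rfl⟩ hz
  simp only [BoundedContinuousFunction.mkOfCompact_apply, ContinuousMap.coe_mk, h2, h3] at h1
  exact h1

lemma aux_weak {X : Type*} [TopologicalSpace X] [PolishSpace X] [LocallyCompactSpace X]
    [T2Space X] [MeasurableSpace X] [BorelSpace X]
    (P : ℕ → Measure X) (Pl : Measure X)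
    [∀ n, IsProbabilityMeasure (P n)] [IsProbabilityMeasure Pl]
    (h : ∀ g : X → ℝ, Continuous g → Filter.Tendsto g (Filter.cocompact X) (nhds 0) →
      Filter.Tendsto (fun n => ∫ x, g x ∂(P n)) Filter.atTop (nhds (∫ x, g x ∂Pl)))
    (f : BoundedContinuousFunction X ℝ) :
      Filter.Tendsto (fun n => ∫ x, f x ∂(P n)) Filter.atTop (nhds (∫ x, f x ∂Pl)) := by
  let := TopologicalSpace.upgradeIsCompletelyMetrizable X
  let P1 : ℕ → ProbabilityMeasure X := fun n => ⟨P n, inferInstance⟩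
  let Q1 : ProbabilityMeasure X := ⟨Pl, inferInstance⟩
  have key : Filter.Tendsto P1
      Filter.atTop (nhds Q1) := by
    apply tendsto_of_forall_isOpen_le_liminf'
    intro G hG
    change Pl G ≤ Filter.liminf (fun n => P n G) Filter.atTop
    rw [hG.measure_eq_iSup_isCompact]
    refine iSup₂_le fun K hKG => iSup_le fun hK => ?_
    obtain ⟨φ, hφ1, hφ0, hφc, hφ⟩ :=
      exists_continuous_one_zero_of_isCompact hK hG.isClosed_compl
        (Set.disjoint_compl_right_iff_subset.2 hKG)
    have hφi : ∀ (μ : Measure X) [IsProbabilityMeasure μ], Integrable φ μ := fun μ _ =>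
      φ.continuous.integrable_of_hasCompactSupport hφc
    have h0 : Filter.Tendsto φ (Filter.cocompact X) (nhds 0) := hφc.is_zero_at_infty
    have ht := (ENNReal.continuous_ofReal.tendsto _).comp (h φ φ.continuous h0)
    have hle : Pl K ≤ ENNReal.ofReal (∫ x, φ x ∂Pl) := by
      rw [ofReal_integral_eq_lintegral_ofReal (hφi Pl) (.of_forall fun x => (hφ x).1),
        ← lintegral_indicator_one hK.measurableSet]
      refine lintegral_mono fun x => ?_
      by_cases hx : x ∈ K
      · simp [hx, hφ1 hx]
      · simp [hx]
    refine hle.trans ?_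
    rw [← ht.liminf_eq]
    refine Filter.liminf_le_liminf (.of_forall fun n => ?_)
    simp only [Function.comp]
    rw [ofReal_integral_eq_lintegral_ofReal (hφi (P n)) (.of_forall fun x => (hφ x).1),
        ← lintegral_indicator_one hG.measurableSet]
    refine lintegral_mono fun x => ?_
    by_cases hx : x ∈ G
    · simpa [hx] using (hφ x).2
    · simp [hx, hφ0 hx]
  exact ProbabilityMeasure.tendsto_iff_forall_integral_tendsto.1 key f

/-- Let `X` be a locally compact Hausdorff Polish space and `k` a reproducing
kernel on `X` (modeled via its feature map `Φ`, `k x y = ⟪Φ x, Φ y⟫`) such that each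
`k(·,x) ∈ C₀(X)` (continuous and vanishing at infinity), and such that
`∬ k dμ dμ > 0` for every nonzero finite signed Borel measure `μ` (written as `μ = μ₁ − μ₂`
with `μ₁ ≠ μ₂` finite Borel measures). If `(P n)` are Borel probability measures with
`D_k(P n, P) = ‖∫ Φ d(P n) − ∫ Φ dP‖ → 0`, then `P n` converges weakly to `P`, i.e.
`∫ f d(P n) → ∫ f dP` for every bounded continuous `f`. -/
theorem stmt_3
    {X : Type*} [TopologicalSpace X] [PolishSpace X] [LocallyCompactSpace X] [T2Space X]
    [MeasurableSpace X] [BorelSpace X]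
    {H : Type*} [NormedAddCommGroup H] [InnerProductSpace ℝ H] [CompleteSpace H]
    (Φ : X → H)
    (hcont : ∀ x : X, Continuous fun y => (⟪Φ y, Φ x⟫ : ℝ))
    (hC0 : ∀ x : X, Filter.Tendsto (fun y => (⟪Φ y, Φ x⟫ : ℝ))
      (Filter.cocompact X) (nhds 0))
    (hpos : ∀ μ₁ μ₂ : Measure X, IsFiniteMeasure μ₁ → IsFiniteMeasure μ₂ → μ₁ ≠ μ₂ →
      0 < (∫ x, ((∫ y, ⟪Φ x, Φ y⟫ ∂μ₁) - ∫ y, ⟪Φ x, Φ y⟫ ∂μ₂) ∂μ₁)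
          - ∫ x, ((∫ y, ⟪Φ x, Φ y⟫ ∂μ₁) - ∫ y, ⟪Φ x, Φ y⟫ ∂μ₂) ∂μ₂)
    (P : ℕ → Measure X) (Pl : Measure X)
    [∀ n, IsProbabilityMeasure (P n)] [IsProbabilityMeasure Pl]
    (hint : ∀ n, Integrable Φ (P n)) (hintl : Integrable Φ Pl)
    (hconv : Filter.Tendsto (fun n => ‖(∫ x, Φ x ∂(P n)) - ∫ x, Φ x ∂Pl‖)
      Filter.atTop (nhds 0)) :
    ∀ f : BoundedContinuousFunction X ℝ,
      Filter.Tendsto (fun n => ∫ x, f x ∂(P n)) Filter.atTop (nhds (∫ x, f x ∂Pl)) := by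
  apply aux_weak P Pl
  intro g hg hg0
  rw [Filter.tendsto_iff_ultrafilter]
  intro U hU
  obtain ⟨Q, hQ, hlim⟩ := aux_limit P U
  have hvec : Filter.Tendsto (fun n => ∫ x, Φ x ∂(P n)) Filter.atTop (nhds (∫ x, Φ x ∂Pl)) :=
    tendsto_iff_norm_sub_tendsto_zero.2 hconv
  have hinner : ∀ (μ : Measure X), Integrable Φ μ → ∀ x,
      ∫ y, (⟪Φ y, Φ x⟫ : ℝ) ∂μ = ⟪∫ y, Φ y ∂μ, Φ x⟫ := fun μ hμ x => by
    rw [real_inner_comm, ← integral_inner hμ]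
    simp only [real_inner_comm]
  have heq : ∀ x, ∫ y, (⟪Φ x, Φ y⟫ : ℝ) ∂Q = ∫ y, (⟪Φ x, Φ y⟫ : ℝ) ∂Pl := fun x => by
    have h1 := hlim _ (hcont x) (hC0 x)
    have h2 : Filter.Tendsto (fun n => ∫ y, (⟪Φ y, Φ x⟫ : ℝ) ∂(P n)) U
        (nhds (∫ y, (⟪Φ y, Φ x⟫ : ℝ) ∂Pl)) := by
      simp only [hinner _ (hint _), hinner _ hintl]
      exact (hvec.inner tendsto_const_nhds).mono_left hU
    have h3 := tendsto_nhds_unique h1 h2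
    simpa only [real_inner_comm] using h3
  have hQP : Q = Pl := by
    by_contra hne
    have := hpos Q Pl hQ inferInstance hne
    simp [heq] at this
  rw [← hQP]
  exact hlim g hg hg0
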